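/- arXiv:2506.04802 — 2 statements merged into one kernel-verified Lean document; each statement's English description precedes it below -/
import Mathlib

section
/- (Self-concordance of η in λ.) Fix x ∈ ℝ^n, μ > 0, ρ > 0 with ρμ < 1. For every λ, h ∈ ℝ^m, the one-variable function g(t) := η(x, λ + t·h; μ, ρ) is three times differentiable on ℝ and satisfies |g'''(t)| ≤ 2·(ρμ)^{−1/2}·(g''(t))^{3/2} for all t ∈ ℝ; that is, η(x,·;μ,ρ) is a ρμ-self-concordant convex function on ℝ^m. -/
open scoped BigOperators

noncomputable def svec {m n : ℕ} (A : Matrix (Fin m) (Fin n) ℝ) (c x : Fin n → ℝ)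
    (lam : Fin m → ℝ) (μ ρ : ℝ) : Fin n → ℝ := fun i =>
  (Real.sqrt ((ρ * x i - c i + A.transpose.mulVec lam i) ^ 2 + 4 * ρ * μ)
    - (ρ * x i - c i + A.transpose.mulVec lam i)) / 2

noncomputable def zvec {m n : ℕ} (A : Matrix (Fin m) (Fin n) ℝ) (c x : Fin n → ℝ)
    (lam : Fin m → ℝ) (μ ρ : ℝ) : Fin n → ℝ := fun i =>
  (Real.sqrt ((ρ * x i - c i + A.transpose.mulVec lam i) ^ 2 + 4 * ρ * μ)
    + (ρ * x i - c i + A.transpose.mulVec lam i)) / 2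

noncomputable def phi {n : ℕ} (y : Fin n → ℝ) : ℝ := -∑ i, Real.log (y i)

noncomputable def Lag {m n : ℕ} (A : Matrix (Fin m) (Fin n) ℝ) (b : Fin m → ℝ)
    (c x : Fin n → ℝ) (lam : Fin m → ℝ) (s : Fin n → ℝ) (μ ρ : ℝ) : ℝ :=
  -(ρ * ∑ j, b j * lam j) + ρ * μ * phi s
    + ρ * ∑ i, x i * (A.transpose.mulVec lam i + s i - c i)
    + (1 / 2) * ∑ i, (A.transpose.mulVec lam i + s i - c i) ^ 2

noncomputable def eta {m n : ℕ} (A : Matrix (Fin m) (Fin n) ℝ) (b : Fin m → ℝ)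
    (c x : Fin n → ℝ) (lam : Fin m → ℝ) (μ ρ : ℝ) : ℝ :=
  Lag A b c x lam (svec A c x lam μ ρ) μ ρ

/-- The positive root `(√(u² + 4κ) + u) / 2` of `z² - u z = κ`. -/
noncomputable def posRoot (κ u : ℝ) : ℝ := (Real.sqrt (u ^ 2 + 4 * κ) + u) / 2

/-- One coordinate of the reduced augmented Lagrangian, up to affine terms. -/
noncomputable def scalarEta (κ u : ℝ) : ℝ :=
  -(κ * Real.log ((Real.sqrt (u ^ 2 + 4 * κ) - u) / 2)) + posRoot κ u ^ 2 / 2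

lemma sqrt_sq_add_pos {κ : ℝ} (hκ : 0 < κ) (u : ℝ) : 0 < Real.sqrt (u ^ 2 + 4 * κ) :=
  Real.sqrt_pos.2 (by positivity)

lemma sq_sqrt_sq_add {κ : ℝ} (hκ : 0 < κ) (u : ℝ) :
    Real.sqrt (u ^ 2 + 4 * κ) ^ 2 = u ^ 2 + 4 * κ :=
  Real.sq_sqrt (by positivity)

lemma abs_lt_sqrt_sq_add {κ : ℝ} (hκ : 0 < κ) (u : ℝ) : |u| < Real.sqrt (u ^ 2 + 4 * κ) :=
  Real.lt_sqrt_of_sq_lt (by rw [sq_abs]; linarith)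

lemma posRoot_pos {κ : ℝ} (hκ : 0 < κ) (u : ℝ) : 0 < posRoot κ u := by
  have := (abs_lt.1 (abs_lt_sqrt_sq_add hκ u)).1
  unfold posRoot
  linarith

lemma le_posRoot_mul_sqrt {κ : ℝ} (hκ : 0 < κ) (u : ℝ) :
    κ ≤ posRoot κ u * Real.sqrt (u ^ 2 + 4 * κ) := by
  have h1 := sq_sqrt_sq_add hκ u
  have h2 := posRoot_pos hκ u
  unfold posRoot at *
  nlinarith [sq_nonneg (Real.sqrt (u ^ 2 + 4 * κ) + u)]

lemma hasDerivAt_sqrt_sq_add {κ : ℝ} (hκ : 0 < κ) (u : ℝ) :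
    HasDerivAt (fun v => Real.sqrt (v ^ 2 + 4 * κ)) (u / Real.sqrt (u ^ 2 + 4 * κ)) u := by
  have h := ((hasDerivAt_pow 2 u).add_const (4 * κ)).sqrt (by positivity)
  refine h.congr_deriv ?_
  have := (sqrt_sq_add_pos hκ u).ne'
  push_cast
  field_simp

lemma hasDerivAt_posRoot {κ : ℝ} (hκ : 0 < κ) (u : ℝ) :
    HasDerivAt (posRoot κ) (posRoot κ u / Real.sqrt (u ^ 2 + 4 * κ)) u := by
  have h := ((hasDerivAt_sqrt_sq_add hκ u).add (hasDerivAt_id u)).div_const 2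
  refine h.congr_deriv ?_
  have := (sqrt_sq_add_pos hκ u).ne'
  unfold posRoot
  field_simp
  ring

lemma hasDerivAt_scalarEta {κ : ℝ} (hκ : 0 < κ) (u : ℝ) :
    HasDerivAt (scalarEta κ) (posRoot κ u) u := by
  have hlt := (abs_lt.1 (abs_lt_sqrt_sq_add hκ u)).2
  have hs := ((hasDerivAt_sqrt_sq_add hκ u).sub (hasDerivAt_id u)).div_const 2
  have hlog := (hs.log (by simp only [id, Pi.sub_apply]; linarith)).const_mul κ
  have h := hlog.neg.add (((hasDerivAt_posRoot hκ u).pow 2).div_const 2)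
  refine h.congr_deriv ?_
  have hr := (sqrt_sq_add_pos hκ u).ne'
  have h1 := sq_sqrt_sq_add hκ u
  have hsu : Real.sqrt (u ^ 2 + 4 * κ) - u ≠ 0 := by linarith
  simp only [id, Pi.sub_apply, posRoot]
  generalize Real.sqrt (u ^ 2 + 4 * κ) = r at *
  obtain rfl : κ = (r ^ 2 - u ^ 2) / 4 := by linarith
  field_simp
  norm_num
  ring

lemma hasDerivAt_posRoot_div_sqrt {κ : ℝ} (hκ : 0 < κ) (u : ℝ) :
    HasDerivAt (fun v => posRoot κ v / Real.sqrt (v ^ 2 + 4 * κ))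
      (2 * κ / Real.sqrt (u ^ 2 + 4 * κ) ^ 3) u := by
  have hr := (sqrt_sq_add_pos hκ u).ne'
  refine ((hasDerivAt_posRoot hκ u).div (hasDerivAt_sqrt_sq_add hκ u) hr).congr_deriv ?_
  have h1 := sq_sqrt_sq_add hκ u
  simp only [posRoot]
  generalize Real.sqrt (u ^ 2 + 4 * κ) = r at *
  obtain rfl : κ = (r ^ 2 - u ^ 2) / 4 := by linarith
  field_simp
  ring

lemma convexOn_scalarEta {κ : ℝ} (hκ : 0 < κ) : ConvexOn ℝ Set.univ (scalarEta κ) := by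
  have hd : deriv (scalarEta κ) = posRoot κ := funext fun u => (hasDerivAt_scalarEta hκ u).deriv
  refine Monotone.convexOn_univ_of_deriv
    (fun u => (hasDerivAt_scalarEta hκ u).differentiableAt) ?_
  rw [hd]
  refine monotone_of_deriv_nonneg (fun u => (hasDerivAt_posRoot hκ u).differentiableAt)
    fun u => ?_
  rw [(hasDerivAt_posRoot hκ u).deriv]
  exact div_nonneg (posRoot_pos hκ u).le (Real.sqrt_nonneg _)

lemma abs_cube_mul_le_rpow {κ : ℝ} (hκ : 0 < κ) (u w : ℝ) :
    |w ^ 3 * (2 * κ / Real.sqrt (u ^ 2 + 4 * κ) ^ 3)| ≤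
      2 * κ ^ (-(1 : ℝ) / 2) *
        (w ^ 2 * (posRoot κ u / Real.sqrt (u ^ 2 + 4 * κ))) ^ ((3 : ℝ) / 2) := by
  have hr := sqrt_sq_add_pos hκ u
  have h1 := le_posRoot_mul_sqrt hκ u
  generalize Real.sqrt (u ^ 2 + 4 * κ) = r at *
  have hle : κ * (|w| / r) ^ 2 ≤ w ^ 2 * (posRoot κ u / r) := by
    rw [div_pow, sq_abs]
    have : κ / r ^ 2 ≤ posRoot κ u / r := by
      rw [div_le_div_iff₀ (by positivity) hr]
      nlinarith
    calc κ * (w ^ 2 / r ^ 2) = w ^ 2 * (κ / r ^ 2) := by ring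
      _ ≤ _ := mul_le_mul_of_nonneg_left this (sq_nonneg w)
  have hpow : (κ * (|w| / r) ^ 2) ^ ((3 : ℝ) / 2) = κ ^ ((3 : ℝ) / 2) * (|w| / r) ^ 3 := by
    have hy : 0 ≤ |w| / r := by positivity
    rw [Real.mul_rpow hκ.le (by positivity), ← Real.rpow_natCast_mul hy]
    norm_num
  have hκ' : κ ^ (-(1 : ℝ) / 2) * κ ^ ((3 : ℝ) / 2) = κ := by
    rw [← Real.rpow_add hκ]
    norm_num
  calc |w ^ 3 * (2 * κ / r ^ 3)| = 2 * κ * (|w| / r) ^ 3 := by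
        rw [abs_mul, abs_pow, abs_of_pos (by positivity : 0 < 2 * κ / r ^ 3)]
        ring
    _ = 2 * κ ^ (-(1 : ℝ) / 2) * (κ * (|w| / r) ^ 2) ^ ((3 : ℝ) / 2) := by
        rw [hpow]
        linear_combination (-2 * (|w| / r) ^ 3) * hκ'
    _ ≤ _ := by gcongr

lemma sum_rpow_three_halves_le {ι : Type*} (s : Finset ι) (q : ι → ℝ) (hq : ∀ i ∈ s, 0 ≤ q i) :
    ∑ i ∈ s, q i ^ ((3 : ℝ) / 2) ≤ (∑ i ∈ s, q i) ^ ((3 : ℝ) / 2) := by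
  have key : ∀ y : ℝ, 0 ≤ y → y ^ ((3 : ℝ) / 2) = y * y ^ ((1 : ℝ) / 2) := fun y hy => by
    rw [show (3 : ℝ) / 2 = 1 + 1 / 2 by norm_num,
      Real.rpow_add_of_nonneg hy (by norm_num) (by norm_num), Real.rpow_one]
  rw [key _ (Finset.sum_nonneg hq), Finset.sum_mul]
  refine Finset.sum_le_sum fun i hi => ?_
  rw [key _ (hq i hi)]
  have := hq i hi
  gcongr
  exact Finset.single_le_sum hq hi

lemma eta_eq_sum_scalarEta {m n : ℕ} (A : Matrix (Fin m) (Fin n) ℝ) (b : Fin m → ℝ)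
    (c x : Fin n → ℝ) (lam : Fin m → ℝ) (μ ρ : ℝ) :
    eta A b c x lam μ ρ = -(ρ * ∑ j, b j * lam j) +
      ∑ i, (scalarEta (ρ * μ) (ρ * x i - c i + A.transpose.mulVec lam i)
        - (ρ * x i) ^ 2 / 2) := by
  simp only [eta, Lag, phi, add_assoc]
  congr 1
  rw [← Finset.sum_neg_distrib, Finset.mul_sum, Finset.mul_sum, Finset.mul_sum,
    ← Finset.sum_add_distrib, ← Finset.sum_add_distrib]
  refine Finset.sum_congr rfl fun i _ => ?_
  simp only [svec, scalarEta, posRoot, mul_assoc]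
  ring

lemma convexOn_eta {m n : ℕ} (A : Matrix (Fin m) (Fin n) ℝ) (b : Fin m → ℝ)
    (c x : Fin n → ℝ) {μ ρ : ℝ} (hκ : 0 < ρ * μ) :
    ConvexOn ℝ Set.univ (fun l : Fin m → ℝ => eta A b c x l μ ρ) := by
  refine ⟨convex_univ, fun l _ k _ p q hp hq hpq => ?_⟩
  simp only [eta_eq_sum_scalarEta, smul_eq_mul]
  have hlin : ∑ j, b j * (p • l + q • k) j = p * ∑ j, b j * l j + q * ∑ j, b j * k j := by
    rw [Finset.mul_sum, Finset.mul_sum, ← Finset.sum_add_distrib]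
    refine Finset.sum_congr rfl fun j _ => ?_
    simp only [Pi.add_apply, Pi.smul_apply, smul_eq_mul]
    ring
  rw [hlin]
  have hsum : ∑ i, (scalarEta (ρ * μ) (ρ * x i - c i + A.transpose.mulVec (p • l + q • k) i)
        - (ρ * x i) ^ 2 / 2) ≤
      p * ∑ i, (scalarEta (ρ * μ) (ρ * x i - c i + A.transpose.mulVec l i)
        - (ρ * x i) ^ 2 / 2) +
      q * ∑ i, (scalarEta (ρ * μ) (ρ * x i - c i + A.transpose.mulVec k i)
        - (ρ * x i) ^ 2 / 2) := by
    rw [Finset.mul_sum, Finset.mul_sum, ← Finset.sum_add_distrib]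
    refine Finset.sum_le_sum fun i _ => ?_
    have h := (convexOn_scalarEta hκ).2
      (Set.mem_univ (ρ * x i - c i + A.transpose.mulVec l i))
      (Set.mem_univ (ρ * x i - c i + A.transpose.mulVec k i)) hp hq hpq
    have harg : ρ * x i - c i + A.transpose.mulVec (p • l + q • k) i =
        p • (ρ * x i - c i + A.transpose.mulVec l i) +
          q • (ρ * x i - c i + A.transpose.mulVec k i) := by
      simp only [Matrix.mulVec_add, Matrix.mulVec_smul, Pi.add_apply, Pi.smul_apply, smul_eq_mul]
      linear_combination (-(ρ * x i - c i)) * hpq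
    rw [harg]
    simp only [smul_eq_mul] at h ⊢
    linear_combination h + (ρ * x i) ^ 2 / 2 * hpq
  linear_combination hsum

lemma hasDerivAt_comp_line {f : ℝ → ℝ} {f' u w t : ℝ} (hf : HasDerivAt f f' (u + t * w)) :
    HasDerivAt (fun τ => f (u + τ * w)) (w * f') t := by
  have h : HasDerivAt (fun τ => u + τ * w) w t := by
    simpa using ((hasDerivAt_id t).mul_const w).const_add u
  exact (hf.comp t h).congr_deriv (mul_comm _ _)

/-- `η(x,·;μ,ρ)` is a `ρμ`-self-concordant convex function:
along every line `t ↦ λ + t h` it is three times differentiable and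
`|g'''(t)| ≤ 2 (ρμ)^(-1/2) (g''(t))^(3/2)`. -/
theorem stmt9 {m n : ℕ} (A : Matrix (Fin m) (Fin n) ℝ) (b : Fin m → ℝ) (c : Fin n → ℝ)
    (x : Fin n → ℝ) (μ ρ : ℝ) (hμ : 0 < μ) (hρ : 0 < ρ) (hρμ : ρ * μ < 1) :
    ConvexOn ℝ Set.univ (fun l : Fin m → ℝ => eta A b c x l μ ρ) ∧
    ∀ lam h : Fin m → ℝ,
      (∀ t : ℝ, DifferentiableAt ℝ (fun t' : ℝ => eta A b c x (lam + t' • h) μ ρ) t) ∧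
      (∀ t : ℝ, DifferentiableAt ℝ
        (deriv fun t' : ℝ => eta A b c x (lam + t' • h) μ ρ) t) ∧
      (∀ t : ℝ, DifferentiableAt ℝ
        (deriv (deriv fun t' : ℝ => eta A b c x (lam + t' • h) μ ρ)) t) ∧
      (∀ t : ℝ,
        |deriv (deriv (deriv fun t' : ℝ => eta A b c x (lam + t' • h) μ ρ)) t| ≤
          2 * (ρ * μ) ^ (-(1 : ℝ) / 2) *
            (deriv (deriv fun t' : ℝ => eta A b c x (lam + t' • h) μ ρ) t) ^ ((3 : ℝ) / 2)) := by
  have hκ : 0 < ρ * μ := mul_pos hρ hμ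
  refine ⟨convexOn_eta A b c x hκ, fun lam h => ?_⟩
  set u : Fin n → ℝ := fun i => ρ * x i - c i + A.transpose.mulVec lam i with hu
  set w : Fin n → ℝ := A.transpose.mulVec h with hw
  have hg : (fun t' : ℝ => eta A b c x (lam + t' • h) μ ρ) = fun t =>
      -(ρ * (∑ j, b j * lam j + t * ∑ j, b j * h j)) +
        ∑ i, (scalarEta (ρ * μ) (u i + t * w i) - (ρ * x i) ^ 2 / 2) := by
    funext t
    rw [eta_eq_sum_scalarEta, Finset.mul_sum (a := t), ← Finset.sum_add_distrib]
    simp only [hu, hw, Matrix.mulVec_add, Matrix.mulVec_smul, Pi.add_apply, Pi.smul_apply,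
      smul_eq_mul, mul_add, add_assoc, mul_left_comm]
  have hd1 : ∀ t, HasDerivAt (fun t' : ℝ => eta A b c x (lam + t' • h) μ ρ)
      (-(ρ * ∑ j, b j * h j) + ∑ i, w i * posRoot (ρ * μ) (u i + t * w i)) t := fun t => by
    rw [hg]
    have hlin : HasDerivAt (fun t : ℝ => -(ρ * (∑ j, b j * lam j + t * ∑ j, b j * h j)))
        (-(ρ * ∑ j, b j * h j)) t := by
      simpa using
        ((((hasDerivAt_id t).mul_const (∑ j, b j * h j)).const_add _).const_mul ρ).fun_neg
    exact hlin.add (HasDerivAt.fun_sum fun i _ =>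
      (hasDerivAt_comp_line (hasDerivAt_scalarEta hκ _)).sub_const _)
  have he1 := funext fun t => (hd1 t).deriv
  have hd2 : ∀ t, HasDerivAt (deriv fun t' : ℝ => eta A b c x (lam + t' • h) μ ρ)
      (∑ i, w i ^ 2 * (posRoot (ρ * μ) (u i + t * w i) /
        Real.sqrt ((u i + t * w i) ^ 2 + 4 * (ρ * μ)))) t := fun t => by
    rw [he1]
    simp only [sq (w _), mul_assoc (w _)]
    exact (HasDerivAt.fun_sum fun i _ =>
      (hasDerivAt_comp_line (hasDerivAt_posRoot hκ _)).const_mul (w i)).const_add _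
  have he2 := funext fun t => (hd2 t).deriv
  have hd3 : ∀ t, HasDerivAt (deriv (deriv fun t' : ℝ => eta A b c x (lam + t' • h) μ ρ))
      (∑ i, w i ^ 3 * (2 * (ρ * μ) / Real.sqrt ((u i + t * w i) ^ 2 + 4 * (ρ * μ)) ^ 3)) t :=
    fun t => by
    rw [he2]
    simp only [pow_succ (w _) 2, mul_assoc (w _ ^ 2)]
    exact HasDerivAt.fun_sum fun i _ =>
      (hasDerivAt_comp_line (hasDerivAt_posRoot_div_sqrt hκ _)).const_mul (w i ^ 2)
  refine ⟨fun t => (hd1 t).differentiableAt, fun t => (hd2 t).differentiableAt,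
    fun t => (hd3 t).differentiableAt, fun t => ?_⟩
  rw [(hd3 t).deriv, (hd2 t).deriv]
  refine (Finset.abs_sum_le_sum_abs _ _).trans
    ((Finset.sum_le_sum fun i _ => abs_cube_mul_le_rpow hκ (u i + t * w i) (w i)).trans ?_)
  rw [← Finset.mul_sum]
  refine mul_le_mul_of_nonneg_left (sum_rpow_three_halves_le _ _ fun i _ => ?_) (by positivity)
  exact mul_nonneg (sq_nonneg _) (div_nonneg (posRoot_pos hκ _).le (Real.sqrt_nonneg _))
end

section
/- (Envelope identity from the proof of Lemma 5.4, orthant case.) Fix x ∈ ℝ^n, λ ∈ ℝ^m, ρ > 0. Then the function μ ↦ η(x,λ;μ,ρ) is differentiable on (0,∞), and its derivative at every μ > 0 equals ρ·φ(s(x,λ;μ,ρ)) = −ρ·∑_{i=1}^n ln s_i(x,λ;μ,ρ). -/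
open scoped BigOperators

/-- The positive root `s = (√(u² + 4t) - u) / 2` of `s (s + u) = t`. -/
theorem posRoot_spec {u t : ℝ} (ht : 0 < t) :
    0 < (Real.sqrt (u ^ 2 + 4 * t) - u) / 2 ∧
      (Real.sqrt (u ^ 2 + 4 * t) - u) / 2 * ((Real.sqrt (u ^ 2 + 4 * t) - u) / 2 + u) = t := by
  have hsq : Real.sqrt (u ^ 2 + 4 * t) ^ 2 = u ^ 2 + 4 * t := Real.sq_sqrt (by positivity)
  have hlt : u < Real.sqrt (u ^ 2 + 4 * t) := Real.lt_sqrt_of_sq_lt (by linarith)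
  exact ⟨by linarith, by linear_combination hsq / 4⟩

theorem svec_pos {m n : ℕ} (A : Matrix (Fin m) (Fin n) ℝ) (c x : Fin n → ℝ)
    (lam : Fin m → ℝ) {μ ρ : ℝ} (hμ : 0 < μ) (hρ : 0 < ρ) (i : Fin n) :
    0 < svec A c x lam μ ρ i := by
  simpa only [svec, mul_assoc] using (posRoot_spec (mul_pos hρ hμ)).1

theorem svec_mul_add {m n : ℕ} (A : Matrix (Fin m) (Fin n) ℝ) (c x : Fin n → ℝ)
    (lam : Fin m → ℝ) {μ ρ : ℝ} (hμ : 0 < μ) (hρ : 0 < ρ) (i : Fin n) :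
    svec A c x lam μ ρ i *
      (svec A c x lam μ ρ i + (ρ * x i - c i + A.transpose.mulVec lam i)) = ρ * μ := by
  simpa only [svec, mul_assoc] using
    (posRoot_spec (u := ρ * x i - c i + A.transpose.mulVec lam i) (mul_pos hρ hμ)).2

theorem differentiableAt_svec {m n : ℕ} (A : Matrix (Fin m) (Fin n) ℝ) (c x : Fin n → ℝ)
    (lam : Fin m → ℝ) {μ ρ : ℝ} (hμ : 0 < μ) (hρ : 0 < ρ) (i : Fin n) :
    DifferentiableAt ℝ (fun μ' => svec A c x lam μ' ρ i) μ := by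
  have hne : (ρ * x i - c i + A.transpose.mulVec lam i) ^ 2 + 4 * ρ * μ ≠ 0 := by positivity
  have hd : DifferentiableAt ℝ
      (fun μ' : ℝ => (ρ * x i - c i + A.transpose.mulVec lam i) ^ 2 + 4 * ρ * μ') μ := by
    fun_prop
  exact ((hd.sqrt hne).sub_const _).div_const 2

/-- The derivative of the augmented Lagrangian along a differentiable curve `s`. -/
theorem hasDerivAt_Lag_comp {m n : ℕ} (A : Matrix (Fin m) (Fin n) ℝ) (b : Fin m → ℝ)
    (c x : Fin n → ℝ) (lam : Fin m → ℝ) {s : ℝ → Fin n → ℝ} {d : Fin n → ℝ} {μ : ℝ} (ρ : ℝ)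
    (hs : ∀ i, HasDerivAt (fun t => s t i) (d i) μ) (hpos : ∀ i, 0 < s μ i) :
    HasDerivAt (fun t => Lag A b c x lam (s t) t ρ)
      (ρ * phi (s μ) + ∑ i, d i *
        (s μ i + (ρ * x i - c i + A.transpose.mulVec lam i) - ρ * μ / s μ i)) μ := by
  have hphi : HasDerivAt (fun t => phi (s t)) (-∑ i, d i / s μ i) μ :=
    (HasDerivAt.fun_sum fun i _ => (hs i).log (hpos i).ne').fun_neg
  have hr (i : Fin n) :
      HasDerivAt (fun t => A.transpose.mulVec lam i + s t i - c i) (d i) μ :=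
    ((hs i).const_add _).sub_const _
  have hlin := (HasDerivAt.fun_sum fun i (_ : i ∈ Finset.univ) =>
    (hr i).const_mul (x i)).const_mul ρ
  have hquad := (HasDerivAt.fun_sum fun i (_ : i ∈ Finset.univ) =>
    (hr i).fun_pow 2).const_mul (1 / 2)
  have hbar := (((hasDerivAt_id' μ).const_mul ρ).fun_mul hphi).const_add
    (-(ρ * ∑ j, b j * lam j))
  refine ((hbar.fun_add hlin).fun_add hquad).congr_deriv ?_
  rw [mul_one, add_assoc, add_assoc, add_right_inj, ← Finset.sum_neg_distrib]
  simp only [Finset.mul_sum, ← Finset.sum_add_distrib]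
  refine Finset.sum_congr rfl fun i _ => ?_
  push_cast
  ring

/-- envelope identity, orthant case: `μ ↦ η(x,λ;μ,ρ)` is differentiable
on `(0,∞)` with derivative `ρ·φ(s(x,λ;μ,ρ)) = -ρ ∑ ln sᵢ(x,λ;μ,ρ)`. -/
theorem stmt16 {m n : ℕ} (A : Matrix (Fin m) (Fin n) ℝ) (b : Fin m → ℝ) (c : Fin n → ℝ)
    (x : Fin n → ℝ) (lam : Fin m → ℝ) (ρ : ℝ) (hρ : 0 < ρ) :
    ∀ μ : ℝ, 0 < μ →
      HasDerivAt (fun μ' : ℝ => eta A b c x lam μ' ρ)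
        (ρ * phi (svec A c x lam μ ρ)) μ := by
  intro μ hμ
  refine (hasDerivAt_Lag_comp A b c x lam ρ
    (fun i => (differentiableAt_svec A c x lam hμ hρ i).hasDerivAt)
    (fun i => svec_pos A c x lam hμ hρ i)).congr_deriv ?_
  rw [add_eq_left]
  refine Finset.sum_eq_zero fun i _ => ?_
  rw [← svec_mul_add A c x lam hμ hρ i,
    mul_div_cancel_left₀ _ (svec_pos A c x lam hμ hρ i).ne', sub_self, mul_zero]
end
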